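/- Let (n, θ) be a closed cycle in which all the values θ i are equal, and let μ : ZMod n → {mountain, valley} be an MV assignment. Then μ is flat foldable as an exterior face if and only if the number of creases i with μ i = mountain exceeds the number of creases i with μ i = valley by exactly 2. -/

import Mathlib

/-- Mountain or valley fold type. -/
inductive MV
  | mountain
  | valley
deriving DecidableEq

/-- Designation of a face as interior or exterior. -/
inductive Des
  | interior
  | exterior
deriving DecidableEq

/-- The sign `ε` used at the top layer: `-1` for an interior face, `+1` for an
exterior face. -/
def epsOf : Des → ℝ
  | Des.interior => -1
  | Des.exterior => 1

/-- The folded coordinates of a closed cycle: `x 0 = 0` and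
`x (i+1) = x i + (-1)^i * θ i`. -/
noncomputable def foldedX (n : ℕ) (θ : ZMod n → ℝ) : ZMod n → ℝ :=
  fun i => ∑ j ∈ Finset.range i.val, (-1 : ℝ) ^ j * θ (j : ZMod n)

/-- `(n, θ)` is a closed cycle: `n` is even, `n ≥ 2`, all edge lengths are
positive, and the alternating sum of the edge lengths is zero. -/
noncomputable def IsClosedCycle (n : ℕ) (θ : ZMod n → ℝ) : Prop :=
  Even n ∧ 2 ≤ n ∧ (∀ i, 0 < θ i) ∧
    ∑ j ∈ Finset.range n, (-1 : ℝ) ^ j * θ (j : ZMod n) = 0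

/-- The open interval whose endpoint set is `{a, b}`. -/
def betw (a b : ℝ) : Set ℝ := Set.Ioo (min a b) (max a b)

/-- `L` is a valid layering of the edges of a cycle folded to coordinates `x`:
`L` is injective; (i) no edge passes strictly between the two edges joined at a
crease at the crease's coordinate; (ii) creases at the same coordinate opening in
the same direction are disjoint or nested. -/
def ValidLayering (n : ℕ) (x L : ZMod n → ℝ) : Prop :=
  Function.Injective L ∧
  (∀ i e : ZMod n, x i ∈ betw (x e) (x (e + 1)) →
      L e ∉ betw (L (i - 1)) (L i)) ∧
  (∀ i j : ZMod n, i ≠ j → x i = x j →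
      Real.sign (x (i + 1) - x i) = Real.sign (x (j + 1) - x j) →
      Disjoint (betw (L (i - 1)) (L i)) (betw (L (j - 1)) (L j)) ∨
        betw (L (i - 1)) (L i) ⊆ betw (L (j - 1)) (L j) ∨
        betw (L (j - 1)) (L j) ⊆ betw (L (i - 1)) (L i))

/-- The layering `L` realizes the MV assignment `μ` with top-layer sign `ε`:
taking `t` to be the index maximizing `L` and `s` the alternating `±1` map with
`s t = ε`, each crease `i` is a valley iff `s (i-1)` equals the sign of
`L i - L (i-1)`. -/
def Realizes (n : ℕ) (L : ZMod n → ℝ) (μ : ZMod n → MV) (ε : ℝ) : Prop :=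
  ∃ t : ZMod n, (∀ j, L j ≤ L t) ∧
    ∃ s : ZMod n → ℝ, (∀ i, s i = 1 ∨ s i = -1) ∧ (∀ i, s (i + 1) = -s i) ∧
      s t = ε ∧
      ∀ i, μ i = MV.valley ↔ s (i - 1) = Real.sign (L i - L (i - 1))

/-- The MV assignment `μ` on the closed cycle `(n, θ)` is flat foldable as a
face with designation `d`: some valid layering of the folded cycle realizes it. -/
noncomputable def FlatFoldable (n : ℕ) (θ : ZMod n → ℝ) (μ : ZMod n → MV)
    (d : Des) : Prop :=
  ∃ L : ZMod n → ℝ, ValidLayering n (foldedX n θ) L ∧ Realizes n L μ (epsOf d)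

/-- The folded diameter of a closed cycle: `max x - min x` over the folded
coordinates. -/
noncomputable def foldedDiameter (n : ℕ) [NeZero n] (θ : ZMod n → ℝ) : ℝ :=
  Finset.univ.sup' ⟨0, Finset.mem_univ 0⟩ (foldedX n θ) -
    Finset.univ.inf' ⟨0, Finset.mem_univ 0⟩ (foldedX n θ)

open Finset in
theorem aux_umlauf (n : ℕ) (hn : 2 ≤ n) (he : Even n) (f : ℕ → ℝ) (h0 : f n = f 0)
    (ht : ∀ k, 0 < k → k < n → f k < f 0)
    (hc : ∀ i j : ℕ, i % 2 = j % 2 →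
      Real.sign (f j - f i) + Real.sign (f (j+1) - f (i+1)) =
        Real.sign (f (j+1) - f i) + Real.sign (f j - f (i+1))) :
    ∑ k ∈ range n, (-1 : ℝ)^k * Real.sign (f (k+1) - f k) = -2 := by
  set σ : ℕ → ℕ → ℝ := fun i j => Real.sign (f j - f i) with hσ
  set S : ℕ → ℝ := fun m => ∑ k ∈ range m, (-1 : ℝ)^k * σ k (k+1) with hS
  set B : ℕ → ℝ := fun m => ∑ i ∈ range m, (-1 : ℝ)^i * (σ (i+1) (m+1) - σ i (m+1)) with hB
  have hstep : ∀ m, B (m+1) - B m =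
      (-1)^m * (σ (m+1) (m+2) - σ m (m+1) - σ 0 (m+2) + σ 0 (m+1)) := by
    intro m
    have h1 : B (m+1) - B m = (∑ i ∈ range m, (-1 : ℝ)^m *
        ((σ (i+1) (m+2) - σ (i+1) (m+1)) - (σ i (m+2) - σ i (m+1))))
        + (-1)^m * (σ (m+1) (m+2) - σ m (m+2)) := by
      simp only [hB, sum_range_succ]
      rw [add_sub_right_comm, ← sum_sub_distrib]
      congr 1
      apply sum_congr rfl
      intro i _
      by_cases hp : i % 2 = (m+1) % 2
      · have := hc i (m+1) hp
        have h2 : (σ (i+1) (m+2) - σ (i+1) (m+1)) - (σ i (m+2) - σ i (m+1)) = 0 := by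
          simp only [hσ]; linarith
        rw [h2]
        have h3 : σ (i+1) (m+2) - σ i (m+2) = σ (i+1) (m+1) - σ i (m+1) := by linarith
        rw [show m+1+1 = m+2 from rfl, h3]; ring
      · have : (-1 : ℝ)^i = (-1)^m := by
          rcases Nat.even_or_odd m with h | h
          · have : Even i := by rw [Nat.even_iff] at *; omega
            rw [h.neg_one_pow, this.neg_one_pow]
          · have : Odd i := by rw [Nat.odd_iff] at *; omega
            rw [h.neg_one_pow, this.neg_one_pow]
        rw [this]; ring
    rw [h1, ← mul_sum, sum_range_sub (fun i => σ i (m+2) - σ i (m+1))]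
    ring
  have htop : ∀ k, 0 < k → k < n → σ 0 k = -1 := by
    intro k h1 h2
    exact Real.sign_of_neg (by linarith [ht k h1 h2])
  have hSs : ∀ m, S (m+1) = S m + (-1)^m * σ m (m+1) := fun m => sum_range_succ _ _
  have hS0 : S 0 = 0 := rfl
  have hB0 : B 0 = 0 := rfl
  have hind : ∀ m, m + 1 < n → B m = - S (m+1) - S m - 1 := by
    intro m
    induction m with
    | zero => intro h; rw [hSs, hS0, hB0, htop 1 (by omega) (by omega)]; norm_num
    | succ m ih =>
      intro h
      have h1 := hstep m
      rw [htop (m+2) (by omega) (by omega), htop (m+1) (by omega) (by omega), ih (by omega)] at h1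
      have h2 := hSs (m+1)
      have h3 := hSs m
      rw [h2, h3]
      rw [h3] at h1
      rw [pow_succ]
      linarith
  obtain ⟨m, rfl⟩ : ∃ m, n = m + 2 := ⟨n - 2, by omega⟩
  have hm : Even m := by rw [Nat.even_iff] at *; omega
  have h1 := hstep m
  rw [htop (m+1) (by omega) (by omega), hind m (by omega), hm.neg_one_pow] at h1
  have h00 : σ 0 (m+2) = 0 := by simp [hσ, h0]
  have h2 := hSs (m+1)
  have h3 := hSs m
  rw [hm.neg_one_pow] at h3
  rw [pow_succ, hm.neg_one_pow] at h2
  have hlast : ∀ i, 0 < i → i < m+2 → σ i (m+2) = 1 := by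
    intro i hi hi2
    exact Real.sign_of_pos (by linarith [ht i hi hi2])
  have hB1 : B (m+1) = 1 := by
    simp only [hB]
    rw [sum_eq_single 0]
    · rw [show m+1+1 = m+2 from rfl, hlast 1 (by omega) (by omega), h00]; norm_num
    · intro i hi hi0
      rw [mem_range] at hi
      rw [show m+1+1 = m+2 from rfl, hlast i (by omega) (by omega), hlast (i+1) (by omega) (by omega)]
      ring
    · simp
  have h4 := hlast (m+1) (by omega) (by omega)
  change S (m+2) = -2
  rw [h00, hB1] at h1
  rw [show m+1+1 = m+2 from rfl] at h2
  rw [h4] at h1 h2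
  linarith

theorem aux_cell (a b c d : ℝ) (hab : a ≠ b) (hac : a ≠ c) (had : a ≠ d) (hbc : b ≠ c)
    (hbd : b ≠ d) (hcd : c ≠ d)
    (h : Disjoint (betw a b) (betw c d) ∨ betw a b ⊆ betw c d ∨ betw c d ⊆ betw a b) :
    Real.sign (c - a) + Real.sign (d - b) = Real.sign (d - a) + Real.sign (c - b) := by
  have key : ∀ u v : ℝ, u ≠ v → (u < v ∧ Real.sign (v - u) = 1) ∨ (v < u ∧ Real.sign (v - u) = -1) := by
    intro u v huv
    rcases lt_or_gt_of_ne huv with h | h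
    · exact Or.inl ⟨h, Real.sign_of_pos (by linarith)⟩
    · exact Or.inr ⟨h, Real.sign_of_neg (by linarith)⟩
  have h1 : min a b < max a b := by simpa [eq_comm] using hab
  have h2 : min c d < max c d := by simpa [eq_comm] using hcd
  unfold betw at h
  rw [Set.Ioo_disjoint_Ioo, Set.Ioo_subset_Ioo_iff h1, Set.Ioo_subset_Ioo_iff h2] at h
  rcases lt_or_gt_of_ne hab with q1 | q1 <;> rcases lt_or_gt_of_ne hcd with q2 | q2 <;>
  simp only [min_eq_left q1.le, max_eq_right q1.le, min_eq_left q2.le, max_eq_right q2.le,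
    min_eq_right q1.le, max_eq_left q1.le, min_eq_right q2.le, max_eq_left q2.le,
    min_le_iff, le_max_iff] at h <;>
  rcases key a c hac with ⟨p1, e1⟩ | ⟨p1, e1⟩ <;> rcases key b d hbd with ⟨p2, e2⟩ | ⟨p2, e2⟩ <;>
  rcases key a d had with ⟨p3, e3⟩ | ⟨p3, e3⟩ <;> rcases key b c hbc with ⟨p4, e4⟩ | ⟨p4, e4⟩ <;>
  rw [e1, e2, e3, e4] <;> first | norm_num; done | (exfalso; grind)

theorem aux_par_add {n : ℕ} [NeZero n] (he : Even n) (a b : ZMod n) :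
    (a + b).val % 2 = (a.val + b.val) % 2 := by
  rw [ZMod.val_add, Nat.mod_mod_of_dvd _ he.two_dvd]

theorem aux_par_cast {n : ℕ} [NeZero n] (he : Even n) (k : ℕ) :
    (k : ZMod n).val % 2 = k % 2 := by
  rw [ZMod.val_natCast, Nat.mod_mod_of_dvd _ he.two_dvd]

theorem aux_par_succ {n : ℕ} [NeZero n] (he : Even n) (a : ZMod n) :
    (a + 1).val % 2 = (a.val + 1) % 2 := by
  have h1 := aux_par_cast he (n := n) 1
  have h2 := aux_par_add he a 1
  simp only [Nat.cast_one] at h1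
  omega

theorem aux_sum {n : ℕ} [NeZero n] (g : ZMod n → ℝ) (t : ZMod n) :
    ∑ i, g i = ∑ k ∈ Finset.range n, g (t + k) := by
  rw [← Equiv.sum_comp (Equiv.addLeft t) g]
  symm
  refine Finset.sum_bij (fun (k : ℕ) _ => (k : ZMod n)) ?_ ?_ ?_ ?_
  · simp
  · intro a ha b hb hab
    rw [Finset.mem_range] at ha hb
    have := congrArg ZMod.val hab
    rwa [ZMod.val_natCast, ZMod.val_natCast, Nat.mod_eq_of_lt ha, Nat.mod_eq_of_lt hb] at this
  · intro b _
    exact ⟨b.val, by simp [ZMod.val_lt], by simp⟩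
  · simp

theorem aux_x {n : ℕ} [NeZero n] (θ : ZMod n → ℝ) (heq : ∀ i j : ZMod n, θ i = θ j)
    (i : ZMod n) : foldedX n θ i = if i.val % 2 = 0 then 0 else θ 0 := by
  unfold foldedX
  rw [Finset.sum_congr rfl (fun j _ => by rw [heq (j : ZMod n) 0]), ← Finset.sum_mul,
    neg_one_geom_sum]
  simp only [Nat.even_iff]
  split_ifs <;> simp

theorem aux_forward (n : ℕ) [NeZero n] (θ : ZMod n → ℝ)
    (hcc : IsClosedCycle n θ) (heq : ∀ i j : ZMod n, θ i = θ j) (L : ZMod n → ℝ)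
    (hL : ValidLayering n (foldedX n θ) L) (t : ZMod n) (ht : ∀ j, L j ≤ L t)
    (s : ZMod n → ℝ) (hs : ∀ i, s (i + 1) = - s i) :
    ∑ i, s (i - 1) * Real.sign (L i - L (i - 1)) = -2 * s t := by
  obtain ⟨he, hn, hpos, -⟩ := hcc
  obtain ⟨hinj, -, hnc⟩ := hL
  have hst : ∀ k : ℕ, s (t + k) = (-1)^k * s t := by
    intro k
    induction k with
    | zero => simp
    | succ k ih =>
      rw [Nat.cast_succ, ← add_assoc, hs, ih, pow_succ]; ring
  have := aux_umlauf n hn he (fun k => L (t + k)) (by simp) ?_ ?_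
  · rw [aux_sum _ (t + 1), mul_comm, ← this, Finset.mul_sum]
    apply Finset.sum_congr rfl
    intro k _
    rw [show t + 1 + (k : ZMod n) - 1 = t + k by ring, hst]
    rw [show t + 1 + (k : ZMod n) = t + ((k + 1 : ℕ) : ZMod n) by push_cast; ring]
    ring
  · intro k h1 h2
    refine lt_of_le_of_ne (by simpa using ht _) ?_
    intro h
    have := hinj h
    have := congrArg ZMod.val (add_left_cancel this)
    rw [ZMod.val_natCast, Nat.mod_eq_of_lt h2] at this
    simp at this
    omega
  · intro i j hij
    have e : ∀ i : ℕ, t + ((i+1 : ℕ) : ZMod n) = t + i + 1 := by intro i; push_cast; ring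
    simp only [e]
    have hp : (t + (i : ZMod n)).val % 2 = (t + (j : ZMod n)).val % 2 := by
      have h1 := aux_par_add he t i
      have h2 := aux_par_add he t j
      have h3 := aux_par_cast (n := n) he i
      have h4 := aux_par_cast (n := n) he j
      omega
    generalize t + (i : ZMod n) = u at *
    generalize t + (j : ZMod n) = v at *
    by_cases huv : u = v
    · subst huv
      rw [← neg_sub (L (u+1)) (L u), Real.sign_neg]; simp
    have pu := aux_par_succ he u
    have pv := aux_par_succ he v
    have pu' := aux_par_succ he (u+1)
    have pv' := aux_par_succ he (v+1)
    have h := hnc (u+1) (v+1) (by simpa using huv) (by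
      rw [aux_x θ heq, aux_x θ heq]
      rw [show (u+1).val % 2 = (v+1).val % 2 by omega]) (by
      simp only [aux_x θ heq]
      rw [show (u+1).val % 2 = (v+1).val % 2 by omega,
        show (u+1+1).val % 2 = (v+1+1).val % 2 by omega])
    rw [add_sub_cancel_right, add_sub_cancel_right] at h
    refine aux_cell _ _ _ _ ?_ ?_ ?_ ?_ ?_ ?_ h
    · intro h; have h := congrArg ZMod.val (hinj h); omega
    · intro h; exact huv (hinj h)
    · intro h; have h := congrArg ZMod.val (hinj h); omega
    · intro h; have h := congrArg ZMod.val (hinj h); omega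
    · intro h; have h := hinj h; exact huv (by simpa using h)
    · intro h; have h := congrArg ZMod.val (hinj h); omega

def auxNC (a b c d : ℤ) : Prop := ((a < c ↔ b < c) ↔ (a < d ↔ b < d))

structure AuxReal (n : ℕ) (w : ℕ → ℤ) (f : ℕ → ℤ) : Prop where
  close : f n = f 0
  inj : ∀ k l, k < l → l < n → f k ≠ f l
  nc : ∀ k l, k < l → l < n → k % 2 = l % 2 → auxNC (f k) (f (k+1)) (f l) (f (l+1))
  sgn : ∀ k, k < n → (f k < f (k+1) ↔ (w k = 1 ↔ k % 2 = 0))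

theorem AuxReal.ne {n : ℕ} {w f} (h : AuxReal n w f) (k l : ℕ) (hkl : k ≠ l) (hk : k ≤ n)
    (hl : l ≤ n) (h1 : k = 0 → l ≠ n) (h2 : l = 0 → k ≠ n) : f k ≠ f l := by
  have key : ∀ k l : ℕ, k < l → l ≤ n → (k = 0 → l ≠ n) → f k ≠ f l := by
    intro k l hkl hl h1
    rcases Nat.lt_or_ge l n with h' | h'
    · exact h.inj k l hkl h'
    · have : l = n := by omega
      subst this
      rw [h.close]
      exact (h.inj 0 k (by omega) hkl).symm
  rcases Nat.lt_or_ge k l with h' | h'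
  · exact key k l h' hl h1
  · exact (key l k (by omega) hk h2).symm

/-- Insert two new edges after edge `i`. -/
def auxIns (f : ℕ → ℤ) (i : ℕ) (p q : ℤ) : ℕ → ℤ := fun k =>
  if k ≤ i then 3 * f k else if k = i + 1 then p else if k = i + 2 then q else 3 * f (k - 2)

theorem auxNC_symm {a b c d : ℤ} (h : auxNC a b c d) (h1 : a ≠ c) (h2 : a ≠ d) (h3 : b ≠ c)
    (h4 : b ≠ d) : auxNC c d a b := by
  unfold auxNC at *
  grind

set_option maxHeartbeats 1000000 in
theorem auxIns_real (n : ℕ) (he : n % 2 = 0) (w w' : ℕ → ℤ) (f : ℕ → ℤ) (h : AuxReal n w f)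
    (i : ℕ) (hi : i < n) (p q : ℤ)
    (hw1 : ∀ k, k < i → w' k = w k) (hw2 : ∀ k, i < k → w' (k+2) = w k)
    (hp : p % 3 ≠ 0) (hq : q % 3 ≠ 0) (hpq : p ≠ q)
    (hs0 : 3 * f i < p ↔ (w' i = 1 ↔ i % 2 = 0))
    (hs1 : p < q ↔ (w' (i+1) = 1 ↔ (i+1) % 2 = 0))
    (hs2 : q < 3 * f (i+1) ↔ (w' (i+2) = 1 ↔ i % 2 = 0))
    (hadj : ∀ c, p < 3 * c ↔ q < 3 * c)
    (hself : auxNC (3 * f i) p q (3 * f (i+1)))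
    (hn1 : ∀ c d, c ≠ f i → c ≠ f (i+1) → d ≠ f i → d ≠ f (i+1) → 
      auxNC (f i) (f (i+1)) c d → auxNC (3 * f i) p (3 * c) (3 * d))
    (hn2 : ∀ c d, c ≠ f i → c ≠ f (i+1) → d ≠ f i → d ≠ f (i+1) → 
      auxNC (f i) (f (i+1)) c d → auxNC q (3 * f (i+1)) (3 * c) (3 * d)) :
    AuxReal (n+2) w' (auxIns f i p q) := by
  have g1 : ∀ k, k ≤ i → auxIns f i p q k = 3 * f k := by intro k hk; simp [auxIns, hk]
  have g2 : auxIns f i p q (i+1) = p := by simp [auxIns]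
  have g3 : auxIns f i p q (i+2) = q := by simp [auxIns]
  have g4 : ∀ k, i < k → auxIns f i p q (k+2) = 3 * f k := by
    intro k hk
    unfold auxIns
    rw [if_neg (by omega), if_neg (by omega), if_neg (by omega)]; rfl
  have sp : ∀ k, k ≤ i ∨ k = i+1 ∨ k = i+2 ∨ ∃ m, i < m ∧ k = m + 2 := by
    intro k
    by_cases h1 : k ≤ i + 2
    · omega
    · exact Or.inr (Or.inr (Or.inr ⟨k - 2, by omega, by omega⟩))
  have sp' : ∀ k, k < i ∨ k = i ∨ k = i+1 ∨ k = i+2 ∨ ∃ m, i < m ∧ k = m + 2 := by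
    intro k
    rcases sp k with h | h | h | h
    · rcases Nat.lt_or_ge k i with h' | h'
      · exact Or.inl h'
      · exact Or.inr (Or.inl (by omega))
    · simp [h]
    · simp [h]
    · exact Or.inr (Or.inr (Or.inr (Or.inr h)))
  have g4' : ∀ m, i < m → auxIns f i p q (m+2+1) = 3 * f (m+1) := by
    intro m hm; exact g4 (m+1) (by omega)
  have g5 : auxIns f i p q (i+2+1) = 3 * f (i+1) := g4 (i+1) (by omega)
  have hsgn : ∀ k, k < n + 2 → (auxIns f i p q k < auxIns f i p q (k+1) ↔
      (w' k = 1 ↔ k % 2 = 0)) := by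
    intro k hk
    rcases sp' k with hk' | rfl | rfl | rfl | ⟨m, hm, rfl⟩
    · clear hs0 hs1 hs2
      rw [g1 k (by omega), g1 (k+1) (by omega), hw1 k hk']
      have := h.sgn k (by omega)
      rw [← this, mul_lt_mul_iff_right₀ (by norm_num)]
    · rw [g1 k le_rfl, g2]; exact hs0
    · rw [g2, g3]; exact hs1
    · rw [g3, g5, hs2, Nat.add_mod_right]
    · clear hs0 hs1 hs2
      rw [g4 m hm, g4' m hm, hw2 m hm]
      have := h.sgn m (by omega)
      rw [Nat.add_mod_right, ← this, mul_lt_mul_iff_right₀ (by norm_num)]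
  clear hs0 hs1 hs2
  -- distinctness of endpoints
  have hd : ∀ k, k < n → k ≠ i → k % 2 = i % 2 →
      f k ≠ f i ∧ f k ≠ f (i+1) ∧ f (k+1) ≠ f i ∧ f (k+1) ≠ f (i+1) := by
    intro k hk hki hpar
    refine ⟨?_, ?_, ?_, ?_⟩ <;> apply h.ne <;> omega
  have hnc : ∀ k, k < n → k ≠ i → k % 2 = i % 2 → auxNC (f i) (f (i+1)) (f k) (f (k+1)) := by
    intro k hk hki hpar
    obtain ⟨d1, d2, d3, d4⟩ := hd k hk hki hpar
    rcases Nat.lt_or_ge k i with h' | h'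
    · exact auxNC_symm (h.nc k i h' hi hpar) d1 d2 d3 d4
    · exact h.nc i k (by omega) hk hpar.symm
  have A1 : ∀ k, k < n → k ≠ i → k % 2 = i % 2 → auxNC (3 * f i) p (3 * f k) (3 * f (k+1)) := by
    intro k hk hki hpar
    obtain ⟨d1, d2, d3, d4⟩ := hd k hk hki hpar
    exact hn1 _ _ d1 d2 d3 d4 (hnc k hk hki hpar)
  have A2 : ∀ k, k < n → k ≠ i → k % 2 = i % 2 →
      auxNC q (3 * f (i+1)) (3 * f k) (3 * f (k+1)) := by
    intro k hk hki hpar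
    obtain ⟨d1, d2, d3, d4⟩ := hd k hk hki hpar
    exact hn2 _ _ d1 d2 d3 d4 (hnc k hk hki hpar)
  have A1' : ∀ k, k < n → k ≠ i → k % 2 = i % 2 → auxNC (3 * f k) (3 * f (k+1)) (3 * f i) p := by
    intro k hk hki hpar
    obtain ⟨d1, d2, d3, d4⟩ := hd k hk hki hpar
    refine auxNC_symm (A1 k hk hki hpar) ?_ ?_ ?_ ?_ <;> omega
  have A2' : ∀ k, k < n → k ≠ i → k % 2 = i % 2 →
      auxNC (3 * f k) (3 * f (k+1)) q (3 * f (i+1)) := by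
    intro k hk hki hpar
    obtain ⟨d1, d2, d3, d4⟩ := hd k hk hki hpar
    refine auxNC_symm (A2 k hk hki hpar) ?_ ?_ ?_ ?_ <;> omega
  have A3 : ∀ c d : ℤ, auxNC p q (3 * c) (3 * d) := by
    intro c d
    have := hadj c
    have := hadj d
    unfold auxNC; tauto
  have A3' : ∀ c d : ℤ, auxNC (3 * c) (3 * d) p q := by
    intro c d
    refine auxNC_symm (A3 c d) ?_ ?_ ?_ ?_ <;> omega
  have A4 : ∀ k l, k < l → l < n → k % 2 = l % 2 →
      auxNC (3 * f k) (3 * f (k+1)) (3 * f l) (3 * f (l+1)) := by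
    intro k l h1 h2 h3
    have := h.nc k l h1 h2 h3
    unfold auxNC at *
    have e : ∀ a b : ℤ, 3 * a < 3 * b ↔ a < b := by intro a b; omega
    simpa only [e] using this
  refine ⟨?_, ?_, ?_, ?_⟩
  · rw [g4 n hi, g1 0 (by omega), h.close]
  · intro k l hkl hl
    rcases sp k with hk' | rfl | rfl | ⟨m, hm, rfl⟩ <;>
    rcases sp l with hl' | rfl | rfl | ⟨m', hm', rfl⟩ <;>
    (try simp only [g2, g3]) <;> try omega
    · rw [g1 k hk', g1 l hl']
      have := h.inj k l hkl (by omega); omega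
    · rw [g1 k hk']; omega
    · rw [g1 k hk']; omega
    · rw [g1 k hk', g4 m' hm']
      have := h.inj k m' (by omega) (by omega); omega
    · rw [g4 m' hm']; omega
    · rw [g4 m' hm']; omega
    · rw [g4 m hm, g4 m' hm']
      have := h.inj m m' (by omega) (by omega); omega
  · intro k l hkl hl hpar
    rcases sp' k with hk' | rfl | rfl | rfl | ⟨m, hm, rfl⟩ <;>
    rcases sp' l with hl' | rfl | rfl | rfl | ⟨m', hm', rfl⟩ <;> try omega
    · rw [g1 k (by omega), g1 l (by omega), g1 (k+1) (by omega), g1 (l+1) (by omega)]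
      exact A4 k l hkl (by omega) hpar
    · rw [g1 k (by omega), g1 (k+1) (by omega), g1 l le_rfl, g2]
      exact A1' k (by omega) (by omega) hpar
    · rw [g1 k (by omega), g1 (k+1) (by omega), g2, g3]
      exact A3' _ _
    · rw [g1 k (by omega), g1 (k+1) (by omega), g3, g5]
      exact A2' k (by omega) (by omega) (by omega)
    · rw [g1 k (by omega), g1 (k+1) (by omega), g4 m' hm', g4' m' hm']
      exact A4 k m' (by omega) (by omega) (by omega)
    · rw [g1 k le_rfl, g2, g3, g5]
      exact hself
    · rw [g1 k le_rfl, g2, g4 m' hm', g4' m' hm']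
      exact A1 m' (by omega) (by omega) (by omega)
    · rw [g2, g3, g4 m' hm', g4' m' hm']
      exact A3 _ _
    · rw [g3, g5, g4 m' hm', g4' m' hm']
      exact A2 m' (by omega) (by omega) (by omega)
    · rw [g4 m hm, g4' m hm, g4 m' hm', g4' m' hm']
      exact A4 m m' (by omega) (by omega) (by omega)
  · exact hsgn

theorem aux_near (u v p q c d : ℤ) (hp : 3 * u - 3 < p ∧ p < 3 * u + 3)
    (hq : 3 * v - 3 < q ∧ q < 3 * v + 3) (c1 : c ≠ u) (c2 : c ≠ v) (d1 : d ≠ u) (d2 : d ≠ v)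
    (h : auxNC u v c d) : auxNC p q (3 * c) (3 * d) := by
  have e1 : p < 3 * c ↔ u < c := by omega
  have e2 : p < 3 * d ↔ u < d := by omega
  have e3 : q < 3 * c ↔ v < c := by omega
  have e4 : q < 3 * d ↔ v < d := by omega
  unfold auxNC at *
  rw [e1, e2, e3, e4]; exact h

open Finset in
theorem aux_exists (r : ℕ) : ∀ (w : ℕ → ℤ), (∀ k, w k = 1 ∨ w k = -1) →
    ∑ k ∈ range (2*r+2), w k = 2 → ∃ f, AuxReal (2*r+2) w f := by
  induction r with
  | zero =>
    intro w hw hsum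
    simp [sum_range_succ] at hsum
    have h0 := hw 0
    have h1 := hw 1
    refine ⟨fun k => if k = 1 then 1 else 0, by simp, ?_, ?_, ?_⟩
    · intro k l hkl hl
      have : k = 0 := by omega
      have : l = 1 := by omega
      subst k l; simp
    · intro k l hkl hl hp; omega
    · intro k hk
      have : k = 0 ∨ k = 1 := by omega
      rcases this with rfl | rfl
      · simp; omega
      · simp; omega
  | succ r ih =>
    intro w hw hsum
    have hex : ∃ i, i + 2 < 2*r+4 ∧ ¬ (w i = w (i+1) ∧ w (i+1) = w (i+2)) := by
      by_contra hcon
      push Not at hcon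
      have hcst : ∀ k, k < 2*r+4 → w k = w 0 := by
        intro k
        induction k with
        | zero => intro _; rfl
        | succ k ihk =>
          intro hk
          rw [← ihk (by omega)]
          by_contra hne
          by_cases hk2 : k + 2 < 2*r+4
          · have := hcon k hk2
            exact hne this.1.symm
          · have := (hcon (k-1) (by omega)).2
            rw [show k - 1 + 1 = k by omega, show k - 1 + 2 = k + 1 by omega] at this
            exact hne this.symm
      have h1 : ∑ k ∈ range (2*(r+1)+2), w k = ∑ k ∈ range (2*(r+1)+2), w 0 :=
        sum_congr rfl (fun k hk => hcst k (by rw [mem_range] at hk; omega))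
      rw [hsum] at h1
      simp at h1
      rcases hw 0 with h | h <;> rw [h] at h1 <;> omega
    obtain ⟨i, hi, hne⟩ := hex
    set X := w i + w (i+1) + w (i+2) with hX
    have hi0 := hw i
    have hi1 := hw (i+1)
    have hi2 := hw (i+2)
    obtain ⟨f, hf⟩ := ih (fun k => if k < i then w k else if k = i then X else w (k+2))
      (by
        intro k
        split_ifs
        · exact hw k
        · omega
        · exact hw (k+2)) (by
        obtain ⟨d, hd⟩ : ∃ d, 2*r+2 = i + (1 + d) := ⟨2*r+2-i-1, by omega⟩
        rw [show 2*(r+1)+2 = i + (3 + d) by omega] at hsum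
        rw [hd]
        rw [sum_range_add, sum_range_add] at hsum ⊢
        rw [← hsum]
        congr 1
        · apply sum_congr rfl
          intro k hk
          rw [mem_range] at hk
          simp [hk]
        · congr 1
          · simp [sum_range_succ, hX]
          · apply sum_congr rfl
            intro k _
            rw [if_neg (by omega), if_neg (by omega)]
            congr 1; omega)
    have hsgn := hf.sgn i (by omega)
    have hab := hf.ne i (i+1) (by omega) (by omega) (by omega) (by omega) (by omega)
    simp only [lt_irrefl, if_false, if_true] at hsgn
    have main : ∀ p q : ℤ, _ → _ → _ → _ → _ → _ → _ → _ → _ → _ →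
        ∃ f, AuxReal (2*(r+1)+2) w f := fun p q a1 a2 a3 a4 a5 a6 a7 a8 a9 a10 =>
      ⟨_, auxIns_real (2*r+2) (by omega) _ w f hf i (by omega) p q
        (by intro k hk; simp [hk])
        (by intro k hk; rw [if_neg (by omega), if_neg (by omega)])
        a1 a2 a3 a4 a5 a6 a7 a8 a9 a10⟩
    generalize f i = a at *
    generalize f (i+1) = b at *
    obtain ⟨D, hD⟩ : ∃ D : ℤ, (D = 1 ∧ a < b) ∨ (D = -1 ∧ b < a) := by
      rcases lt_or_gt_of_ne hab with h | h
      · exact ⟨1, Or.inl ⟨rfl, h⟩⟩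
      · exact ⟨-1, Or.inr ⟨rfl, h⟩⟩
    have hpat : (w i = X ∧ w (i+1) = -X ∧ w (i+2) = X) ∨ (w i = X ∧ w (i+1) = X ∧ w (i+2) = -X) ∨
        (w i = -X ∧ w (i+1) = X ∧ w (i+2) = X) := by omega
    have hXX : X = 1 ∨ X = -1 := by omega
    clear_value X
    have hpar : (i+1) % 2 = 0 ↔ ¬ (i % 2 = 0) := by omega
    rw [hpar] at main
    clear hpar hi0 hi1 hi2 hne ih hf hi hsum hw hX
    generalize w i = w0 at *
    generalize w (i+1) = w1 at *
    generalize w (i+2) = w2 at *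
    generalize (i % 2 = 0) = P at *
    have hself : auxNC a a a a := by simp [auxNC]
    have hs : ∀ u c d, auxNC u u c d := by simp [auxNC]
    rcases hpat with ⟨e0, e1, e2⟩ | ⟨e0, e1, e2⟩ | ⟨e0, e1, e2⟩
    · refine main (3*a+D) (3*a+2*D) ?_ ?_ ?_ ?_ ?_ ?_ ?_ ?_ (fun c d c1 c2 d1 d2 h => ?_)
        (fun c d c1 c2 d1 d2 h => ?_) <;> clear main
      · clear hsgn; omega
      · clear hsgn; omega
      · clear hsgn; omega
      · rcases hD with ⟨rfl, hD⟩ | ⟨rfl, hD⟩ <;> rcases hXX with rfl | rfl <;> subst e0 e1 e2 <;> by_cases hP : P <;> simp [hP] at hsgn ⊢ <;> omega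
      · rcases hD with ⟨rfl, hD⟩ | ⟨rfl, hD⟩ <;> rcases hXX with rfl | rfl <;> subst e0 e1 e2 <;> by_cases hP : P <;> simp [hP] at hsgn ⊢ <;> omega
      · rcases hD with ⟨rfl, hD⟩ | ⟨rfl, hD⟩ <;> rcases hXX with rfl | rfl <;> subst e0 e1 e2 <;> by_cases hP : P <;> simp [hP] at hsgn ⊢ <;> omega
      · intro c; clear hsgn; omega
      · clear hsgn; unfold auxNC; omega
      · clear hsgn; exact aux_near a a _ _ c d (by omega) (by omega) c1 c1 d1 d1 (hs _ _ _)
      · clear hsgn; exact aux_near a b _ _ c d (by omega) (by omega) c1 c2 d1 d2 h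
    · refine main (3*b+2*D) (3*b+D) ?_ ?_ ?_ ?_ ?_ ?_ ?_ ?_ (fun c d c1 c2 d1 d2 h => ?_)
        (fun c d c1 c2 d1 d2 h => ?_) <;> clear main
      · clear hsgn; omega
      · clear hsgn; omega
      · clear hsgn; omega
      · rcases hD with ⟨rfl, hD⟩ | ⟨rfl, hD⟩ <;> rcases hXX with rfl | rfl <;> subst e0 e1 e2 <;> by_cases hP : P <;> simp [hP] at hsgn ⊢ <;> omega
      · rcases hD with ⟨rfl, hD⟩ | ⟨rfl, hD⟩ <;> rcases hXX with rfl | rfl <;> subst e0 e1 e2 <;> by_cases hP : P <;> simp [hP] at hsgn ⊢ <;> omega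
      · rcases hD with ⟨rfl, hD⟩ | ⟨rfl, hD⟩ <;> rcases hXX with rfl | rfl <;> subst e0 e1 e2 <;> by_cases hP : P <;> simp [hP] at hsgn ⊢ <;> omega
      · intro c; clear hsgn; omega
      · clear hsgn; unfold auxNC; omega
      · clear hsgn; exact aux_near a b _ _ c d (by omega) (by omega) c1 c2 d1 d2 h
      · clear hsgn; exact aux_near b b _ _ c d (by omega) (by omega) c2 c2 d2 d2 (hs _ _ _)
    · refine main (3*a-D) (3*a-2*D) ?_ ?_ ?_ ?_ ?_ ?_ ?_ ?_ (fun c d c1 c2 d1 d2 h => ?_)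
        (fun c d c1 c2 d1 d2 h => ?_) <;> clear main
      · clear hsgn; omega
      · clear hsgn; omega
      · clear hsgn; omega
      · rcases hD with ⟨rfl, hD⟩ | ⟨rfl, hD⟩ <;> rcases hXX with rfl | rfl <;> subst e0 e1 e2 <;> by_cases hP : P <;> simp [hP] at hsgn ⊢ <;> omega
      · rcases hD with ⟨rfl, hD⟩ | ⟨rfl, hD⟩ <;> rcases hXX with rfl | rfl <;> subst e0 e1 e2 <;> by_cases hP : P <;> simp [hP] at hsgn ⊢ <;> omega
      · rcases hD with ⟨rfl, hD⟩ | ⟨rfl, hD⟩ <;> rcases hXX with rfl | rfl <;> subst e0 e1 e2 <;> by_cases hP : P <;> simp [hP] at hsgn ⊢ <;> omega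
      · intro c; clear hsgn; omega
      · clear hsgn; unfold auxNC; omega
      · clear hsgn; exact aux_near a a _ _ c d (by omega) (by omega) c1 c1 d1 d1 (hs _ _ _)
      · clear hsgn; exact aux_near a b _ _ c d (by omega) (by omega) c1 c2 d1 d2 h

theorem aux_nc_betw (a b c d : ℤ) (hab : a ≠ b) (hac : a ≠ c) (had : a ≠ d) (hbc : b ≠ c)
    (hbd : b ≠ d) (hcd : c ≠ d) (h : auxNC a b c d) :
    Disjoint (betw a b) (betw c d) ∨ betw a b ⊆ betw c d ∨ betw c d ⊆ betw a b := by
  have h1 : min (a : ℝ) b < max (a : ℝ) b := by simpa [eq_comm] using hab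
  have h2 : min (c : ℝ) d < max (c : ℝ) d := by simpa [eq_comm] using hcd
  unfold betw
  rw [Set.Ioo_disjoint_Ioo, Set.Ioo_subset_Ioo_iff h1, Set.Ioo_subset_Ioo_iff h2]
  unfold auxNC at h
  norm_cast
  omega

theorem aux_card {n : ℕ} [NeZero n] (μ : ZMod n → MV) :
    (∑ i, if μ i = MV.valley then (1 : ℝ) else -1) =
      ((Finset.univ.filter fun i : ZMod n => μ i = MV.valley).card : ℝ) -
      (Finset.univ.filter fun i : ZMod n => μ i = MV.mountain).card := by
  rw [Finset.card_filter, Finset.card_filter]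
  push_cast
  rw [← Finset.sum_sub_distrib]
  apply Finset.sum_congr rfl
  intro i _
  cases μ i <;> simp

theorem aux_term {n : ℕ} [NeZero n] (hn : 2 ≤ n) (μ : ZMod n → MV) (L s : ZMod n → ℝ)
    (hinj : Function.Injective L) (hs : ∀ i, s i = 1 ∨ s i = -1)
    (hμ : ∀ i, μ i = MV.valley ↔ s (i - 1) = Real.sign (L i - L (i - 1))) :
    ∑ i, s (i - 1) * Real.sign (L i - L (i - 1)) =
      ((Finset.univ.filter fun i : ZMod n => μ i = MV.valley).card : ℝ) -
      (Finset.univ.filter fun i : ZMod n => μ i = MV.mountain).card := by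
  have : Fact (1 < n) := ⟨hn⟩
  rw [← aux_card]
  apply Finset.sum_congr rfl
  intro i _
  have hne : L i - L (i-1) ≠ 0 := by
    intro h
    have := hinj (sub_eq_zero.mp h)
    have h1 : (1 : ZMod n) = 0 := by
      calc (1 : ZMod n) = i - (i - 1) := by ring
        _ = 0 := by rw [← this]; ring
    exact one_ne_zero h1
  rw [if_congr (hμ i) rfl rfl]
  rcases Real.sign_apply_eq_of_ne_zero _ hne with h | h <;> rcases hs (i-1) with h' | h' <;>
    rw [h, h'] <;> norm_num

theorem aux_backward (n : ℕ) [NeZero n] (θ : ZMod n → ℝ)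
    (hcc : IsClosedCycle n θ) (heq : ∀ i j : ZMod n, θ i = θ j) (μ : ZMod n → MV)
    (hμ : (Finset.univ.filter fun i : ZMod n => μ i = MV.mountain).card =
        (Finset.univ.filter fun i : ZMod n => μ i = MV.valley).card + 2) :
    FlatFoldable n θ μ Des.exterior := by
  have hcc' := hcc
  obtain ⟨he, hn, hpos, -⟩ := hcc
  have : Fact (1 < n) := ⟨hn⟩
  obtain ⟨r, hr⟩ : ∃ r, n = 2 * r + 2 := by
    obtain ⟨m, hm⟩ := he
    exact ⟨m - 1, by omega⟩
  have hex : ∃ f, AuxReal n (fun k => if μ (((k+1 : ℕ)) : ZMod n) = MV.valley then -1 else 1) f := by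
    have := aux_exists r (fun k => if μ (((k+1 : ℕ)) : ZMod n) = MV.valley then -1 else 1)
      (by intro k; split_ifs <;> simp) ?_
    · rwa [← hr] at this
    · rw [← hr]
      have h1 := aux_card μ
      rw [aux_sum _ 1] at h1
      rw [hμ] at h1
      have h2 : (∑ k ∈ Finset.range n, (if μ (((k+1 : ℕ)) : ZMod n) = MV.valley then -1 else 1 : ℤ) : ℝ) = 2 := by
        push_cast at h1 ⊢
        have : ∀ k ∈ Finset.range n, (if μ ((k : ZMod n) + 1) = MV.valley then (-1 : ℝ) else 1) =
            - (if μ (1 + (k : ZMod n)) = MV.valley then (1 : ℝ) else -1) := by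
          intro k _
          rw [add_comm]; split_ifs <;> simp
        rw [Finset.sum_congr rfl this, Finset.sum_neg_distrib, h1]; ring
      exact_mod_cast h2
  obtain ⟨f, hf⟩ := hex
  set L : ZMod n → ℝ := fun i => f i.val with hL
  have hLk : ∀ k : ℕ, k ≤ n → L (k : ZMod n) = f k := by
    intro k hk
    simp only [hL, ZMod.val_natCast]
    rcases Nat.lt_or_ge k n with h | h
    · rw [Nat.mod_eq_of_lt h]
    · have : k = n := by omega
      subst this
      rw [Nat.mod_self, hf.close]
  have hinj : Function.Injective L := by
    intro i j hij
    simp only [hL, Int.cast_inj] at hij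
    apply ZMod.val_injective
    by_contra hne
    rcases lt_or_gt_of_ne hne with h | h
    · exact hf.inj _ _ h (ZMod.val_lt _) hij
    · exact hf.inj _ _ h (ZMod.val_lt _) hij.symm
  have hcr : ∀ i : ZMod n, L (i - 1) = f (i-1).val ∧ L i = f ((i-1).val + 1) := by
    intro i
    refine ⟨rfl, ?_⟩
    rw [← hLk _ (by have := ZMod.val_lt (i-1); omega)]
    simp
  have hval : ValidLayering n (foldedX n θ) L := by
    refine ⟨hinj, ?_, ?_⟩
    · intro i e hx
      exfalso
      unfold betw at hx
      simp only [aux_x θ heq, Set.mem_Ioo, min_lt_iff, lt_max_iff] at hx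
      have := hpos 0
      split_ifs at hx <;> simp at hx <;> first | done | linarith | (rcases hx with ⟨_ | _, _ | _⟩ <;> linarith)
    · intro i j hij hx _
      have hp : i.val % 2 = j.val % 2 := by
        have := hpos 0
        simp only [aux_x θ heq] at hx
        split_ifs at hx <;> first | omega | (exfalso; linarith)
      have pi := aux_par_succ he (i-1)
      have pj := aux_par_succ he (j-1)
      rw [sub_add_cancel] at pi pj
      have hki := ZMod.val_lt (i-1)
      have hkj := ZMod.val_lt (j-1)
      have hne : (i-1).val ≠ (j-1).val := by
        intro h
        have := ZMod.val_injective n h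
        exact hij (by simpa using this)
      rw [(hcr i).1, (hcr i).2, (hcr j).1, (hcr j).2]
      generalize (i-1).val = k at *
      generalize (j-1).val = l at *
      have hn2 : n % 2 = 0 := Nat.even_iff.mp he
      have dd : f k ≠ f l ∧ f k ≠ f (l+1) ∧ f (k+1) ≠ f l ∧ f (k+1) ≠ f (l+1) ∧
          f k ≠ f (k+1) ∧ f l ≠ f (l+1) := by
        refine ⟨?_, ?_, ?_, ?_, ?_, ?_⟩ <;> apply hf.ne <;> omega
      obtain ⟨d1, d2, d3, d4, d5, d6⟩ := dd
      apply aux_nc_betw <;> try assumption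
      rcases lt_or_gt_of_ne hne with h | h
      · exact hf.nc k l h hkj (by omega)
      · exact auxNC_symm (hf.nc l k h hki (by omega)) d1.symm d3.symm d2.symm d4.symm
  set s : ZMod n → ℝ := fun i => if i.val % 2 = 0 then -1 else 1 with hs
  have hs1 : ∀ i, s i = 1 ∨ s i = -1 := by
    intro i; simp only [hs]; split_ifs <;> simp
  have hs2 : ∀ i, s (i+1) = - s i := by
    intro i
    have := aux_par_succ he i
    simp only [hs]
    split_ifs <;> first | omega | simp
  have hreal : ∀ i, μ i = MV.valley ↔ s (i - 1) = Real.sign (L i - L (i - 1)) := by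
    intro i
    have hk := ZMod.val_lt (i-1)
    have hsg := hf.sgn _ hk
    have hne : f (i-1).val ≠ f ((i-1).val+1) := by apply hf.ne <;> omega
    rw [(hcr i).1, (hcr i).2]
    have hi : (((i-1).val + 1 : ℕ) : ZMod n) = i := by simp
    simp only [hi] at hsg
    simp only [hs]
    generalize (i-1).val = k at *
    rcases lt_or_gt_of_ne hne with h | h
    · have h' : (f k : ℝ) < f (k+1) := by exact_mod_cast h
      rw [Real.sign_of_pos (by linarith)]
      have := hsg.mp h
      by_cases hv : μ i = MV.valley <;> by_cases hk2 : k % 2 = 0 <;> simp [hv, hk2] at this ⊢ <;> norm_num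
    · have h' : (f (k+1) : ℝ) < f k := by exact_mod_cast h
      rw [Real.sign_of_neg (by linarith)]
      have := (not_congr hsg).mp (by omega)
      by_cases hv : μ i = MV.valley <;> by_cases hk2 : k % 2 = 0 <;> simp [hv, hk2] at this ⊢ <;> norm_num
  obtain ⟨t, ht⟩ := Finite.exists_max L
  refine ⟨L, hval, t, ht, s, hs1, hs2, ?_, hreal⟩
  have h1 := aux_forward n θ hcc' heq L hval t ht s hs2
  rw [aux_term hn μ L s hinj hs1 hreal, hμ] at h1
  push_cast at h1
  change s t = 1
  linarith

/-- Case B: an MV assignment on a closed cycle with all edge lengths equal is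
flat foldable as an exterior face iff there are exactly 2 more mountains than
valleys. -/
theorem equal_lengths_exterior (n : ℕ) [NeZero n] (θ : ZMod n → ℝ)
    (hcc : IsClosedCycle n θ) (heq : ∀ i j : ZMod n, θ i = θ j)
    (μ : ZMod n → MV) :
    FlatFoldable n θ μ Des.exterior ↔
      (Finset.univ.filter fun i : ZMod n => μ i = MV.mountain).card =
        (Finset.univ.filter fun i : ZMod n => μ i = MV.valley).card + 2 := by
  constructor
  · rintro ⟨L, hL, t, ht, s, hs1, hs2, hst, hμ⟩
    have h1 := aux_forward n θ hcc heq L hL t ht s hs2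
    rw [aux_term hcc.2.1 μ L s hL.1 hs1 hμ, hst] at h1
    have h2 : ((Finset.univ.filter fun i : ZMod n => μ i = MV.mountain).card : ℝ) =
        (Finset.univ.filter fun i : ZMod n => μ i = MV.valley).card + 2 := by
      simp only [epsOf] at h1
      linarith
    exact_mod_cast h2
  · exact aux_backward n θ hcc heq μ
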